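/- The much larger inclusion 𝐭 ∩ 𝐫 ⋐ 𝐭 holds: 𝐭 ∩ 𝐫 ⊊ 𝐭 and there exists a countable collection {D_j}_{j∈ℕ} ⊆ 𝐭 ∩ 𝐫 of nonempty pairwise disjoint subsets of ℕ such that for every infinite subset K ⊆ ℕ, the union ⋃_{k∈K} D_k belongs to 𝐭 \ (𝐭 ∩ 𝐫). -/

import Mathlib

open Filter

/-- The ideal `𝐟` of all finite subsets of `ℕ`. -/
def finIdeal : Set (Set ℕ) := {A : Set ℕ | A.Finite}

/-- `C ⊆ D mod 𝐟`: the set `C \ D` is finite. -/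
def ModF (C D : Set ℕ) : Prop := (C \ D).Finite

/-- The infinite arithmetic progression `a ℕ₀ + b = {a k + b : k ∈ ℕ₀}`. -/
def apSet (a b : ℕ) : Set ℕ := {m : ℕ | ∃ k : ℕ, m = a * k + b}

/-- `ℛ`: the set of all finite unions of infinite arithmetic progressions
`⋃_{i=1}^n (a_i ℕ₀ + b_i)` with `n ∈ ℕ` and `a_i, b_i ∈ ℕ = {1, 2, 3, …}`. -/
def calR : Set (Set ℕ) :=
  {B : Set ℕ | ∃ n : ℕ, ∃ a b : Fin (n + 1) → ℕ,
    (∀ i, 0 < a i) ∧ (∀ i, 0 < b i) ∧ B = ⋃ i, apSet (a i) (b i)}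

/-- The infinite tiling `(⋃_{j=0}^∞ (T + j r)) + b` of a tile `T` of length `r`. -/
def tiling (r b : ℕ) (T : Set ℕ) : Set ℕ :=
  {m : ℕ | ∃ t ∈ T, ∃ j : ℕ, m = t + j * r + b}

/-- `𝒯`: the set of all infinite tilings `(⋃_{j=0}^∞ (T + j r)) + b` with
`r, b ∈ ℕ = {1, 2, 3, …}` and `T ⊆ {0, 1, …, r - 1}` a tile of length `r`. -/
def calT : Set (Set ℕ) :=
  {A : Set ℕ | ∃ r b : ℕ, 0 < r ∧ 0 < b ∧
    ∃ T : Set ℕ, T ⊆ Set.Iio r ∧ A = tiling r b T}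

/-- `|X ∩ [1, n]|`. -/
noncomputable def cnt (X : Set ℕ) (n : ℕ) : ℕ := Nat.card ↥(X ∩ Set.Icc 1 n)

/-- `X` has density `δ`, i.e. `d(X) := lim_{n→∞} |X ∩ [1,n]| / n = δ`. -/
def HasDensity (X : Set ℕ) (δ : ℝ) : Prop :=
  Tendsto (fun n : ℕ => (cnt X n : ℝ) / n) atTop (nhds δ)

/-- The ideal `𝐝` of all subsets of `ℕ` with density zero. -/
def densIdeal : Set (Set ℕ) := {X : Set ℕ | HasDensity X 0}

/-- `|X ∩ [k+1, k+n]|`. -/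
noncomputable def cntI (X : Set ℕ) (k n : ℕ) : ℕ := Nat.card ↥(X ∩ Set.Icc (k + 1) (k + n))

/-- `max_{k ∈ ℕ₀} |X ∩ [k+1, k+n]|`. -/
noncomputable def maxCnt (X : Set ℕ) (n : ℕ) : ℕ := sSup {m : ℕ | ∃ k : ℕ, m = cntI X k n}

/-- The ideal `𝐛` of all subsets of `ℕ` with Banach density
`b(X) := lim_{n→∞} max_{k∈ℕ₀} |X ∩ [k+1, k+n]| / n` equal to zero. -/
def banachIdeal : Set (Set ℕ) :=
  {X : Set ℕ | Tendsto (fun n : ℕ => (maxCnt X n : ℝ) / n) atTop (nhds 0)}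

/-- The tile density `tile(X) := inf { d(A) : A ∈ 𝒯, X ⊆ A mod 𝐟 }`. -/
noncomputable def tileDens (X : Set ℕ) : ℝ :=
  sInf {δ : ℝ | ∃ A ∈ calT, ModF X A ∧ HasDensity A δ}

/-- The ideal `𝐭` of all subsets of `ℕ` with tile density zero. -/
def tileIdeal : Set (Set ℕ) := {X : Set ℕ | tileDens X = 0}

/-- The Buck density `buck(X) := inf { d(B) : B ∈ ℛ, X ⊆ B mod 𝐟 }`. -/
noncomputable def buckDens (X : Set ℕ) : ℝ :=
  sInf {δ : ℝ | ∃ B ∈ calR, ModF X B ∧ HasDensity B δ}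

/-- The ideal `𝐫` of all subsets of `ℕ` whose reciprocal series converges. -/
def recipIdeal : Set (Set ℕ) := {X : Set ℕ | Summable (X.indicator fun x : ℕ => (1 : ℝ) / x)}

/-- `𝐢 ⋐ 𝐣`: `𝐣` is much larger than `𝐢`, i.e. `𝐢 ⊊ 𝐣` and there is a countable
collection `{D_j}` of nonempty pairwise disjoint members of `𝐢` such that for every
infinite `K ⊆ ℕ` the union `⋃_{k∈K} D_k` lies in `𝐣 \ 𝐢`. -/
def MuchLarger (i j : Set (Set ℕ)) : Prop :=
  i ⊂ j ∧ ∃ D : ℕ → Set ℕ,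
    (∀ n, D n ∈ i) ∧ (∀ n, (D n).Nonempty) ∧
    (∀ m n, m ≠ n → Disjoint (D m) (D n)) ∧
    (∀ K : Set ℕ, K.Infinite → (⋃ k ∈ K, D k) ∈ j ∧ (⋃ k ∈ K, D k) ∉ i)

theorem mem_tiling_singleton_zero {r m : ℕ} (hr : 0 < r) :
    m ∈ tiling r r {0} ↔ 0 < m ∧ r ∣ m := by
  simp only [tiling, Set.mem_ofPred_eq, Set.mem_singleton_iff, exists_eq_left]
  constructor
  · rintro ⟨j, rfl⟩
    exact ⟨by omega, ⟨j + 1, by ring⟩⟩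
  · rintro ⟨hm, c, rfl⟩
    obtain ⟨c, rfl⟩ := Nat.exists_eq_succ_of_ne_zero (Nat.pos_of_mul_pos_left hm).ne'
    exact ⟨c, by rw [Nat.succ_eq_add_one]; ring⟩

theorem cnt_tiling_singleton_zero {r : ℕ} (hr : 0 < r) (n : ℕ) :
    cnt (tiling r r {0}) n = n / r := by
  have h : tiling r r {0} ∩ Set.Icc 1 n = ↑((Finset.Ioc 0 n).filter (r ∣ ·)) := by
    ext m
    simp only [Set.mem_inter_iff, mem_tiling_singleton_zero hr, Set.mem_Icc, Finset.coe_filter,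
      Finset.mem_Ioc, Set.mem_ofPred_eq]
    constructor
    · rintro ⟨⟨hm, hdvd⟩, -, hmn⟩
      exact ⟨⟨hm, hmn⟩, hdvd⟩
    · rintro ⟨⟨hm, hmn⟩, hdvd⟩
      exact ⟨⟨hm, hdvd⟩, hm, hmn⟩
  rw [cnt, h, Nat.card_coe_set_eq, Set.ncard_coe_finset, Nat.Ioc_filter_dvd_card_eq_div]

theorem hasDensity_tiling_singleton_zero {r : ℕ} (hr : 0 < r) :
    HasDensity (tiling r r {0}) (r : ℝ)⁻¹ := by
  have h := (tendsto_nat_floor_mul_div_atTop (R := ℝ) (a := (r : ℝ)⁻¹) (by positivity)).comp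
    tendsto_natCast_atTop_atTop
  refine h.congr fun n => ?_
  simp only [Function.comp_apply]
  rw [cnt_tiling_singleton_zero hr, mul_comm, ← div_eq_mul_inv, Nat.floor_div_eq_div]

theorem HasDensity.nonneg {X : Set ℕ} {δ : ℝ} (h : HasDensity X δ) : 0 ≤ δ :=
  ge_of_tendsto' h fun _ => by positivity

/-- A set whose elements are, up to finitely many exceptions, divisible by every fixed power of
two has tile density zero. -/
theorem mem_tileIdeal_of_finite_not_dvd {X : Set ℕ}
    (h : ∀ j : ℕ, {x ∈ X | ¬ (0 < x ∧ 2 ^ j ∣ x)}.Finite) : X ∈ tileIdeal := by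
  have hmem (j : ℕ) : ((2 ^ j : ℕ) : ℝ)⁻¹ ∈
      {δ : ℝ | ∃ A ∈ calT, ModF X A ∧ HasDensity A δ} := by
    have hj : 0 < 2 ^ j := by positivity
    refine ⟨tiling (2 ^ j) (2 ^ j) {0}, ⟨2 ^ j, 2 ^ j, hj, hj, {0}, by simp, rfl⟩, ?_,
      hasDensity_tiling_singleton_zero hj⟩
    refine (h j).subset fun x hx => ⟨hx.1, ?_⟩
    rw [← mem_tiling_singleton_zero hj]
    exact hx.2
  have hnonneg : ∀ δ ∈ {δ : ℝ | ∃ A ∈ calT, ModF X A ∧ HasDensity A δ}, 0 ≤ δ := by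
    rintro δ ⟨A, -, -, hA⟩
    exact hA.nonneg
  refine le_antisymm (le_of_forall_pos_le_add fun ε hε => ?_) (Real.sInf_nonneg hnonneg)
  obtain ⟨j, hj⟩ := exists_pow_lt_of_lt_one hε (y := (2 : ℝ)⁻¹) (by norm_num)
  have := csInf_le ⟨0, hnonneg⟩ (hmem j)
  rw [tileDens, zero_add]
  refine this.trans ?_
  push_cast
  rw [← inv_pow]
  exact hj.le

theorem Set.Finite.mem_tileIdeal {X : Set ℕ} (hX : X.Finite) : X ∈ tileIdeal :=
  mem_tileIdeal_of_finite_not_dvd fun _ => hX.subset (Set.sep_subset _ _)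

theorem Set.Finite.mem_recipIdeal {X : Set ℕ} (hX : X.Finite) : X ∈ recipIdeal :=
  summable_of_hasFiniteSupport (hX.subset Set.support_indicator_subset)

theorem exists_one_le_sum_inv_two_pow_mul_odd (k : ℕ) :
    ∃ M : ℕ, 1 ≤ ∑ i ∈ Finset.range M, (1 : ℝ) / ((2 ^ k * (2 * i + 1) : ℕ) : ℝ) := by
  have h : ¬ Summable fun i : ℕ => (1 : ℝ) / ((2 ^ k * (2 * i + 1) : ℕ) : ℝ) := by
    intro hs
    have h1 := hs.mul_left ((2 : ℝ) ^ (k + 1))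
    refine Real.not_summable_natCast_inv ((summable_nat_add_iff 1).1 ?_)
    refine h1.of_nonneg_of_le (fun i => by positivity) fun i => ?_
    push_cast
    rw [inv_eq_one_div, pow_succ, mul_one_div, div_le_div_iff₀ (by positivity) (by positivity)]
    nlinarith [pow_pos (two_pos : (0 : ℝ) < 2) k]
  have ht := not_summable_iff_tendsto_nat_atTop_of_nonneg (fun i => by positivity) |>.1 h
  exact (ht.eventually_ge_atTop 1).exists

/-- Finite blocks of numbers with 2-adic valuation exactly `k` and reciprocal sum at least `1`. -/
theorem exists_finset_two_pow_mul_odd_one_le_sum_inv : ∃ F : ℕ → Finset ℕ,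
    (∀ k, ∀ x ∈ F k, ∃ i, x = 2 ^ k * (2 * i + 1)) ∧
    ∀ k, 1 ≤ ∑ x ∈ F k, (1 : ℝ) / x := by
  choose M hM using exists_one_le_sum_inv_two_pow_mul_odd
  refine ⟨fun k => (Finset.range (M k)).image fun i => 2 ^ k * (2 * i + 1), ?_, fun k => ?_⟩
  · intro k x hx
    obtain ⟨i, -, rfl⟩ := Finset.mem_image.1 hx
    exact ⟨i, rfl⟩
  · rw [Finset.sum_image]
    · exact hM k
    · intro a _ b _ hab
      have := Nat.eq_of_mul_eq_mul_left (by positivity : 0 < 2 ^ k) hab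
      omega

theorem two_pow_mul_odd_ne_of_lt {m n : ℕ} (h : m < n) (i j : ℕ) :
    2 ^ m * (2 * i + 1) ≠ 2 ^ n * (2 * j + 1) := by
  intro he
  obtain ⟨c, rfl⟩ := Nat.exists_eq_add_of_lt h
  have : 2 ^ m * (2 * i + 1) = 2 ^ m * (2 * (2 ^ c * (2 * j + 1))) := by rw [he]; ring
  have := Nat.eq_of_mul_eq_mul_left (by positivity : 0 < 2 ^ m) this
  omega

theorem not_mem_recipIdeal_of_forall_exists_finset {X : Set ℕ}
    (h : ∀ N : ℕ, ∃ t : Finset ℕ, ↑t ⊆ X ∧ (∀ x ∈ t, N < x) ∧ 1 ≤ ∑ x ∈ t, (1 : ℝ) / x) :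
    X ∉ recipIdeal := by
  intro hX
  obtain ⟨s, hs⟩ := summable_iff_vanishing_norm.1 hX 1 one_pos
  obtain ⟨t, htX, hN, ht⟩ := h (s.sup id)
  have hd : Disjoint t s := Finset.disjoint_left.2 fun x hx hxs =>
    (hN x hx).not_ge (Finset.le_sup (f := id) hxs)
  have h1 := hs t hd
  rw [Finset.sum_congr rfl fun x hx => Set.indicator_of_mem (htX hx) _] at h1
  exact (ht.trans (Real.le_norm_self _)).not_gt h1

/-- The much larger inclusion `𝐭 ∩ 𝐫 ⋐ 𝐭`. -/
theorem tile_inter_recip_muchLarger_tile :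
    MuchLarger (tileIdeal ∩ recipIdeal) tileIdeal := by
  obtain ⟨F, hF, hsum⟩ := exists_finset_two_pow_mul_odd_one_le_sum_inv
  have htile (K : Set ℕ) : (⋃ k ∈ K, (F k : Set ℕ)) ∈ tileIdeal := by
    refine mem_tileIdeal_of_finite_not_dvd fun j => ?_
    refine ((Finset.range j).biUnion F).finite_toSet.subset ?_
    rintro x ⟨hx, hxj⟩
    simp only [Set.mem_iUnion, Finset.mem_coe] at hx
    obtain ⟨k, -, hx⟩ := hx
    rw [Finset.mem_coe, Finset.mem_biUnion]
    refine ⟨k, Finset.mem_range.2 (lt_of_not_ge fun hjk => hxj ?_), hx⟩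
    obtain ⟨i, rfl⟩ := hF k x hx
    exact ⟨by positivity, (pow_dvd_pow 2 hjk).mul_right _⟩
  have hrecip (K : Set ℕ) (hK : K.Infinite) : (⋃ k ∈ K, (F k : Set ℕ)) ∉ recipIdeal := by
    refine not_mem_recipIdeal_of_forall_exists_finset fun N => ?_
    obtain ⟨k, hkK, hk⟩ := hK.exists_gt N
    refine ⟨F k, Set.subset_biUnion_of_mem (u := fun k => (F k : Set ℕ)) hkK,
      fun x hx => ?_, hsum k⟩
    obtain ⟨i, rfl⟩ := hF k x hx
    exact (hk.trans Nat.lt_two_pow_self).trans_le (Nat.le_mul_of_pos_right _ (by omega))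
  refine ⟨⟨Set.inter_subset_left, fun h => hrecip Set.univ Set.infinite_univ (h (htile _)).2⟩,
    fun k => F k, fun n => ⟨(F n).finite_toSet.mem_tileIdeal, (F n).finite_toSet.mem_recipIdeal⟩,
    fun n => ?_, fun m n hmn => ?_, fun K hK => ⟨htile K, fun h => hrecip K hK h.2⟩⟩
  · rw [Finset.coe_nonempty, Finset.nonempty_iff_ne_empty]
    intro h
    have := hsum n
    rw [h, Finset.sum_empty] at this
    linarith
  · refine Set.disjoint_left.2 fun x hxm hxn => ?_
    obtain ⟨i, hi⟩ := hF m x hxm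
    obtain ⟨j, hj⟩ := hF n x hxn
    rcases hmn.lt_or_gt with h | h
    · exact two_pow_mul_odd_ne_of_lt h i j (hi.symm.trans hj)
    · exact two_pow_mul_odd_ne_of_lt h j i (hj.symm.trans hi)
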